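/- arXiv:1009.0099 — 7 statements merged into one kernel-verified Lean document; each statement's English description precedes it below -/
import Mathlib

section
/- Let H₁, H₂, H₃ be real Hilbert spaces and let B = (B_{ij})_{i,j=1}^3 be a self-adjoint continuous linear operator matrix on H₁ × H₂ × H₃ (B_{ij}* = B_{ji}). Then B is positive definite if and only if the following ten conditions hold (each inverse appearing below exists because the corresponding operator is self-adjoint positive definite by the preceding conditions): (1) B₁₁ ≫ 0; (2) B₂₂ ≫ 0; (3) B₃₃ ≫ 0; (4) B₂₂ − B₂₁B₁₁⁻¹B₁₂ ≫ 0; (5) B₂₂ − B₂₃B₃₃⁻¹B₃₂ ≫ 0; (6) B₃₃ − B₃₁B₁₁⁻¹B₁₃ ≫ 0; (7) B₃₃ − B₃₂B₂₂⁻¹B₂₃ ≫ 0; (8) (B₂₂ − B₂₁B₁₁⁻¹B₁₂) − (B₂₃ − B₂₁B₁₁⁻¹B₁₃)·(B₃₃ − B₃₁B₁₁⁻¹B₁₃)⁻¹·(B₃₂ − B₃₁B₁₁⁻¹B₁₂) ≫ 0; (9) (B₃₃ − B₃₁B₁₁⁻¹B₁₃) − (B₃₂ − B₃₁B₁₁⁻¹B₁₂)·(B₂₂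 − B₂₁B₁₁⁻¹B₁₂)⁻¹·(B₂₃ − B₂₁B₁₁⁻¹B₁₃) ≫ 0; (10) B₁₁ − (B₁₂, B₁₃)·C⁻¹·(B₂₁, B₃₁)ᵗ ≫ 0, where C denotes the 2×2 operator matrix (B_{ij})_{i,j=2}^3 acting on H₂ × H₃ (which is invertible, being self-adjoint positive definite by (2),(3),(5),(7)). -/
open ContinuousLinearMap RealInnerProductSpace

noncomputable section

/-- A continuous linear operator `B` on a real Hilbert space is *positive definite*
(`B ≫ 0`) if there is `c > 0` with `⟪B h, h⟫ ≥ c‖h‖²` for all `h`. -/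
def IsPosDef {H : Type*} [NormedAddCommGroup H] [InnerProductSpace ℝ H]
    (B : H →L[ℝ] H) : Prop :=
  ∃ c > 0, ∀ h : H, c * ‖h‖ ^ 2 ≤ ⟪B h, h⟫

section SchurComplement

variable {X Y : Type*} [NormedAddCommGroup X] [InnerProductSpace ℝ X]
  [NormedAddCommGroup Y] [InnerProductSpace ℝ Y]

theorem IsPosDef.isUnit [CompleteSpace X] {A : X →L[ℝ] X} (hA : IsPosDef A) : IsUnit A := by
  obtain ⟨c, hc, h⟩ := hA
  refine isUnit_of_forall_le_norm_inner_map A (c := ⟨c, hc.le⟩) hc fun x => ?_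
  rw [mul_comm]
  exact (h x).trans (le_abs_self _)

theorem apply_ringInverse {E : Type*} [NormedAddCommGroup E] [NormedSpace ℝ E]
    {A : E →L[ℝ] E} (hA : IsUnit A) (x : E) : A (Ring.inverse A x) = x := by
  rw [← mul_apply_eq_comp, Ring.mul_inverse_cancel A hA, one_apply_eq_self]

theorem inner_ringInverse_left {A : X →L[ℝ] X} (hA : IsUnit A)
    (hsymm : ∀ x y, ⟪A x, y⟫ = ⟪x, A y⟫) (x y : X) :
    ⟪Ring.inverse A x, y⟫ = ⟪x, Ring.inverse A y⟫ := by
  conv_lhs => rw [← apply_ringInverse hA y]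
  rw [← hsymm, apply_ringInverse hA]

/-- A coercive `2 × 2` block form has a positive definite corner and Schur complement. -/
theorem isPosDef_and_schurComplement_of_coercive [CompleteSpace X]
    {A : X →L[ℝ] X} {C : Y →L[ℝ] X} {C' : X →L[ℝ] Y} {D : Y →L[ℝ] Y}
    (h : ∃ c > 0, ∀ x y, c * (‖x‖ ^ 2 + ‖y‖ ^ 2) ≤ ⟪A x + C y, x⟫ + ⟪C' x + D y, y⟫) :
    IsPosDef A ∧ IsPosDef (D - C' ∘L Ring.inverse A ∘L C) := by
  obtain ⟨c, hc, h⟩ := h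
  have hA : IsPosDef A := ⟨c, hc, fun x => by simpa using h x 0⟩
  refine ⟨hA, c, hc, fun y => ?_⟩
  have key := h (-Ring.inverse A (C y)) y
  have hform : ⟪A (-Ring.inverse A (C y)) + C y, -Ring.inverse A (C y)⟫ +
      ⟪C' (-Ring.inverse A (C y)) + D y, y⟫ = ⟪(D - C' ∘L Ring.inverse A ∘L C) y, y⟫ := by
    simp [apply_ringInverse hA.isUnit, sub_eq_neg_add]
  rw [hform] at key
  nlinarith [sq_nonneg ‖-Ring.inverse A (C y)‖]

/-- Completing the square: a positive definite form in the shifted variable `x + L y` plus a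
coercive form in `y` is jointly coercive. -/
theorem coercive_of_shift {Z : Type*} {A : X →L[ℝ] X} (hA : IsPosDef A) (L : Z → X) (N q : Z → ℝ)
    (hL : ∃ K ≥ 0, ∀ z, ‖L z‖ ^ 2 ≤ K * N z) (hN : ∀ z, 0 ≤ N z)
    (hq : ∃ b > 0, ∀ z, b * N z ≤ q z) :
    ∃ c > 0, ∀ x z, c * (‖x‖ ^ 2 + N z) ≤ ⟪A (x + L z), x + L z⟫ + q z := by
  obtain ⟨a, ha, hA⟩ := hA
  obtain ⟨K, hK, hL⟩ := hL
  obtain ⟨b, hb, hq⟩ := hq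
  refine ⟨min (a / 2) (b / (2 * K + 1)), by positivity, fun x z => ?_⟩
  set c := min (a / 2) (b / (2 * K + 1))
  have hc : 0 ≤ c := by positivity
  have hca : 2 * c ≤ a := by linarith [min_le_left (a / 2) (b / (2 * K + 1))]
  have hcb : c * (2 * K + 1) ≤ b :=
    (le_div_iff₀ (by positivity)).1 (min_le_right (a / 2) (b / (2 * K + 1)))
  have hx : ‖x‖ ^ 2 ≤ 2 * ‖x + L z‖ ^ 2 + 2 * (K * N z) := by
    have htri : ‖x‖ ≤ ‖x + L z‖ + ‖L z‖ := by simpa using norm_sub_le (x + L z) (L z)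
    nlinarith [hL z, norm_nonneg x, sq_nonneg (‖x + L z‖ - ‖L z‖)]
  calc c * (‖x‖ ^ 2 + N z)
      ≤ c * (2 * ‖x + L z‖ ^ 2 + 2 * (K * N z) + N z) := by gcongr
    _ = 2 * c * ‖x + L z‖ ^ 2 + c * (2 * K + 1) * N z := by ring
    _ ≤ a * ‖x + L z‖ ^ 2 + b * N z := by
      have := hN z
      gcongr
    _ ≤ _ := add_le_add (hA _) (hq z)

/-- Expansion of a symmetric form at a point shifted by `A⁻¹ u`. -/
theorem inner_map_add_ringInverse {A : X →L[ℝ] X} (hA : IsUnit A)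
    (hsymm : ∀ x y, ⟪A x, y⟫ = ⟪x, A y⟫) (x u : X) :
    ⟪A (x + Ring.inverse A u), x + Ring.inverse A u⟫ =
      ⟪A x, x⟫ + 2 * ⟪u, x⟫ + ⟪u, Ring.inverse A u⟫ := by
  rw [map_add, apply_ringInverse hA, inner_add_left, inner_add_right, inner_add_right,
    hsymm x (Ring.inverse A u), apply_ringInverse hA, real_inner_comm x u]
  ring

/-- A symmetric `2 × 2` block form with positive definite corner and Schur complement is
coercive. -/
theorem coercive_of_schurComplement [CompleteSpace X]
    {A : X →L[ℝ] X} {C : Y →L[ℝ] X} {C' : X →L[ℝ] Y} {D : Y →L[ℝ] Y}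
    (hsymm : ∀ x y, ⟪A x, y⟫ = ⟪x, A y⟫) (hC : ∀ x y, ⟪C' x, y⟫ = ⟪x, C y⟫)
    (hA : IsPosDef A) (hS : IsPosDef (D - C' ∘L Ring.inverse A ∘L C)) :
    ∃ c > 0, ∀ x y, c * (‖x‖ ^ 2 + ‖y‖ ^ 2) ≤ ⟪A x + C y, x⟫ + ⟪C' x + D y, y⟫ := by
  obtain ⟨c, hc, h⟩ := coercive_of_shift hA (Ring.inverse A ∘L C) (fun y => ‖y‖ ^ 2)
    (fun y => ⟪(D - C' ∘L Ring.inverse A ∘L C) y, y⟫)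
    ⟨‖Ring.inverse A ∘L C‖ ^ 2, by positivity, fun y => by
      rw [← mul_pow]
      gcongr
      exact le_opNorm _ _⟩
    (fun y => by positivity) hS
  refine ⟨c, hc, fun x y => (h x y).trans_eq ?_⟩
  simp only [comp_apply, sub_apply, inner_map_add_ringInverse hA.isUnit hsymm, inner_add_left,
    inner_sub_left, hC, real_inner_comm x (C y), real_inner_comm (Ring.inverse A (C y)) (C y)]
  ring

/-- A coercive `2 × 2` block operator on the product is invertible. -/
theorem isUnit_prod_coprod_of_coercive [CompleteSpace X] [CompleteSpace Y]
    {A : X →L[ℝ] X} {C : Y →L[ℝ] X} {C' : X →L[ℝ] Y} {D : Y →L[ℝ] Y}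
    (h : ∃ c > 0, ∀ x y, c * (‖x‖ ^ 2 + ‖y‖ ^ 2) ≤ ⟪A x + C y, x⟫ + ⟪C' x + D y, y⟫) :
    IsUnit ((A.coprod C).prod (C'.coprod D)) := by
  obtain ⟨hA, hS⟩ := isPosDef_and_schurComplement_of_coercive h
  obtain ⟨c, hc, h⟩ := h
  rw [isUnit_iff_bijective]
  constructor
  · rw [injective_iff_map_eq_zero]
    rintro ⟨x, y⟩ hxy
    obtain ⟨hx, hy⟩ : A x + C y = 0 ∧ C' x + D y = 0 := by simpa using hxy
    have key := h x y
    rw [hx, hy, inner_zero_left, inner_zero_left, add_zero] at key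
    have hsum : ‖x‖ ^ 2 + ‖y‖ ^ 2 ≤ 0 := nonpos_of_mul_nonpos_right key hc
    have hx0 : ‖x‖ ^ 2 = 0 := by nlinarith [sq_nonneg ‖x‖, sq_nonneg ‖y‖]
    have hy0 : ‖y‖ ^ 2 = 0 := by nlinarith [sq_nonneg ‖x‖, sq_nonneg ‖y‖]
    simpa using And.intro hx0 hy0
  · rintro ⟨u, v⟩
    have hy := apply_ringInverse hS.isUnit (v - C' (Ring.inverse A u))
    set y := Ring.inverse (D - C' ∘L Ring.inverse A ∘L C) (v - C' (Ring.inverse A u))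
    refine ⟨(Ring.inverse A (u - C y), y), ?_⟩
    simp only [sub_apply, comp_apply] at hy
    simp only [prod_apply, coprod_apply, apply_ringInverse hA.isUnit, map_sub, sub_add_cancel,
      Prod.mk.injEq, true_and]
    rw [sub_add_eq_add_sub, add_sub_assoc, hy, add_sub_cancel]

end SchurComplement

theorem statement2
    {H₁ H₂ H₃ : Type*}
    [NormedAddCommGroup H₁] [InnerProductSpace ℝ H₁] [CompleteSpace H₁]
    [NormedAddCommGroup H₂] [InnerProductSpace ℝ H₂] [CompleteSpace H₂]
    [NormedAddCommGroup H₃] [InnerProductSpace ℝ H₃] [CompleteSpace H₃]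
    (B₁₁ : H₁ →L[ℝ] H₁) (B₁₂ : H₂ →L[ℝ] H₁) (B₁₃ : H₃ →L[ℝ] H₁)
    (B₂₁ : H₁ →L[ℝ] H₂) (B₂₂ : H₂ →L[ℝ] H₂) (B₂₃ : H₃ →L[ℝ] H₂)
    (B₃₁ : H₁ →L[ℝ] H₃) (B₃₂ : H₂ →L[ℝ] H₃) (B₃₃ : H₃ →L[ℝ] H₃)
    (h₁₁ : adjoint B₁₁ = B₁₁) (h₂₂ : adjoint B₂₂ = B₂₂) (h₃₃ : adjoint B₃₃ = B₃₃)
    (h₁₂ : adjoint B₁₂ = B₂₁) (h₁₃ : adjoint B₁₃ = B₃₁) (h₂₃ : adjoint B₂₃ = B₃₂) :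
    -- the operator matrix `B` is positive definite on `H₁ × H₂ × H₃` (ℓ²-product)
    (∃ c > 0, ∀ (h₁ : H₁) (h₂ : H₂) (h₃ : H₃),
        c * (‖h₁‖ ^ 2 + ‖h₂‖ ^ 2 + ‖h₃‖ ^ 2) ≤
          ⟪B₁₁ h₁ + B₁₂ h₂ + B₁₃ h₃, h₁⟫ + ⟪B₂₁ h₁ + B₂₂ h₂ + B₂₃ h₃, h₂⟫ +
            ⟪B₃₁ h₁ + B₃₂ h₂ + B₃₃ h₃, h₃⟫) ↔
      (IsPosDef B₁₁ ∧ IsPosDef B₂₂ ∧ IsPosDef B₃₃ ∧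
        IsPosDef (B₂₂ - B₂₁ ∘L Ring.inverse B₁₁ ∘L B₁₂) ∧
        IsPosDef (B₂₂ - B₂₃ ∘L Ring.inverse B₃₃ ∘L B₃₂) ∧
        IsPosDef (B₃₃ - B₃₁ ∘L Ring.inverse B₁₁ ∘L B₁₃) ∧
        IsPosDef (B₃₃ - B₃₂ ∘L Ring.inverse B₂₂ ∘L B₂₃) ∧
        IsPosDef ((B₂₂ - B₂₁ ∘L Ring.inverse B₁₁ ∘L B₁₂) -
          (B₂₃ - B₂₁ ∘L Ring.inverse B₁₁ ∘L B₁₃) ∘L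
            Ring.inverse (B₃₃ - B₃₁ ∘L Ring.inverse B₁₁ ∘L B₁₃) ∘L
              (B₃₂ - B₃₁ ∘L Ring.inverse B₁₁ ∘L B₁₂)) ∧
        IsPosDef ((B₃₃ - B₃₁ ∘L Ring.inverse B₁₁ ∘L B₁₃) -
          (B₃₂ - B₃₁ ∘L Ring.inverse B₁₁ ∘L B₁₂) ∘L
            Ring.inverse (B₂₂ - B₂₁ ∘L Ring.inverse B₁₁ ∘L B₁₂) ∘L
              (B₂₃ - B₂₁ ∘L Ring.inverse B₁₁ ∘L B₁₃)) ∧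
        IsPosDef (B₁₁ - (B₁₂.coprod B₁₃) ∘L
          Ring.inverse ((B₂₂.coprod B₂₃).prod (B₃₂.coprod B₃₃)) ∘L (B₂₁.prod B₃₁))) := by
  have a₁₁ (x y : H₁) : ⟪B₁₁ x, y⟫ = ⟪x, B₁₁ y⟫ := by rw [← adjoint_inner_left, h₁₁]
  have a₂₂ (x y : H₂) : ⟪B₂₂ x, y⟫ = ⟪x, B₂₂ y⟫ := by rw [← adjoint_inner_left, h₂₂]
  have a₂₁ (x : H₁) (y : H₂) : ⟪B₂₁ x, y⟫ = ⟪x, B₁₂ y⟫ := by rw [← adjoint_inner_left, h₁₂]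
  have a₃₁ (x : H₁) (y : H₃) : ⟪B₃₁ x, y⟫ = ⟪x, B₁₃ y⟫ := by rw [← adjoint_inner_left, h₁₃]
  have a₃₂ (x : H₂) (y : H₃) : ⟪B₃₂ x, y⟫ = ⟪x, B₂₃ y⟫ := by rw [← adjoint_inner_left, h₂₃]
  constructor
  · rintro ⟨c, hc, h⟩
    have h₁₂' := isPosDef_and_schurComplement_of_coercive (A := B₁₁) (C := B₁₂) (C' := B₂₁)
      (D := B₂₂) ⟨c, hc, fun x y => by simpa using h x y 0⟩
    have h₁₃' := isPosDef_and_schurComplement_of_coercive (A := B₁₁) (C := B₁₃) (C' := B₃₁)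
      (D := B₃₃) ⟨c, hc, fun x y => by simpa using h x 0 y⟩
    have hC : ∃ c > 0, ∀ x y, c * (‖x‖ ^ 2 + ‖y‖ ^ 2) ≤
        ⟪B₂₂ x + B₂₃ y, x⟫ + ⟪B₃₂ x + B₃₃ y, y⟫ := ⟨c, hc, fun x y => by simpa using h 0 x y⟩
    have h₂₃' := isPosDef_and_schurComplement_of_coercive hC
    have h₃₂' := isPosDef_and_schurComplement_of_coercive (A := B₃₃) (C := B₃₂) (C' := B₂₃)
      (D := B₂₂) ⟨c, hc, fun x y => by
        have := h 0 y x
        simp only [map_zero, zero_add, norm_zero, inner_zero_right] at this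
        rw [add_comm (B₃₃ x), add_comm (B₂₃ x), add_comm ⟪_, x⟫, add_comm (‖x‖ ^ 2)]
        simpa using this⟩
    have hS (x : H₂) (y : H₃) : c * (‖x‖ ^ 2 + ‖y‖ ^ 2) ≤
        ⟪(B₂₂ - B₂₁ ∘L Ring.inverse B₁₁ ∘L B₁₂) x +
          (B₂₃ - B₂₁ ∘L Ring.inverse B₁₁ ∘L B₁₃) y, x⟫ +
        ⟪(B₃₂ - B₃₁ ∘L Ring.inverse B₁₁ ∘L B₁₂) x +
          (B₃₃ - B₃₁ ∘L Ring.inverse B₁₁ ∘L B₁₃) y, y⟫ := by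
      have key := h (-(Ring.inverse B₁₁ (B₁₂ x) + Ring.inverse B₁₁ (B₁₃ y))) x y
      simp only [map_neg, map_add, apply_ringInverse h₁₂'.1.isUnit, neg_add_rev, inner_add_left,
        inner_neg_left] at key
      simp only [sub_apply, comp_apply, inner_add_left, inner_sub_left]
      nlinarith [sq_nonneg ‖-Ring.inverse B₁₁ (B₁₃ y) + -Ring.inverse B₁₁ (B₁₂ x)‖]
    refine ⟨h₁₂'.1, h₂₃'.1, h₃₂'.1, h₁₂'.2, h₃₂'.2, h₁₃'.2, h₂₃'.2,
      (isPosDef_and_schurComplement_of_coercive ⟨c, hc, fun x y => ?_⟩).2,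
      (isPosDef_and_schurComplement_of_coercive ⟨c, hc, hS⟩).2, c, hc, fun x => ?_⟩
    · have := hS y x
      rw [add_comm (‖x‖ ^ 2), add_comm _ ⟪_, y⟫]
      simpa only [add_comm] using this
    · have hz := apply_ringInverse (isUnit_prod_coprod_of_coercive hC) (B₂₁ x, B₃₁ x)
      simp only [sub_apply, comp_apply, prod_apply B₂₁ B₃₁]
      generalize Ring.inverse ((B₂₂.coprod B₂₃).prod (B₃₂.coprod B₃₃)) (B₂₁ x, B₃₁ x) = z at hz ⊢
      obtain ⟨y, z⟩ := z
      obtain ⟨hy, hz⟩ : B₂₂ y + B₂₃ z = B₂₁ x ∧ B₃₂ y + B₃₃ z = B₃₁ x := by simpa using hz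
      have key := h x (-y) (-z)
      simp only [map_neg, ← hy, ← hz, inner_add_left, inner_neg_left, norm_neg] at key
      simp only [coprod_apply, inner_sub_left, inner_add_left]
      nlinarith [sq_nonneg ‖y‖, sq_nonneg ‖z‖]
  · rintro ⟨p₁, -, -, p₄, -, -, -, -, p₉, -⟩
    have hinv := inner_ringInverse_left p₁.isUnit a₁₁
    have a₁₂ (x : H₂) (y : H₁) : ⟪B₁₂ x, y⟫ = ⟪x, B₂₁ y⟫ := by
      rw [real_inner_comm, ← a₂₁, real_inner_comm]
    have hS := coercive_of_schurComplement
      (fun x y => by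
        simp only [sub_apply, comp_apply, inner_sub_left, inner_sub_right, a₂₂, a₂₁, hinv, a₁₂])
      (fun x y => by
        simp only [sub_apply, comp_apply, inner_sub_left, inner_sub_right, a₃₂, a₃₁, hinv, a₁₂])
      p₄ p₉
    obtain ⟨b, hb, hS⟩ := hS
    obtain ⟨c, hc, h⟩ := coercive_of_shift p₁ (Ring.inverse B₁₁ ∘L B₁₂.coprod B₁₃)
      (fun z : H₂ × H₃ => ‖z.1‖ ^ 2 + ‖z.2‖ ^ 2) _
      ⟨‖Ring.inverse B₁₁ ∘L B₁₂.coprod B₁₃‖ ^ 2, by positivity, fun z => by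
        have hz : ‖z‖ ^ 2 ≤ ‖z.1‖ ^ 2 + ‖z.2‖ ^ 2 := by
          rcases max_choice ‖z.1‖ ‖z.2‖ with hmax | hmax <;>
            rw [Prod.norm_def, hmax] <;> nlinarith [sq_nonneg ‖z.1‖, sq_nonneg ‖z.2‖]
        calc _ ≤ (‖Ring.inverse B₁₁ ∘L B₁₂.coprod B₁₃‖ * ‖z‖) ^ 2 := by
              gcongr
              exact le_opNorm _ _
          _ ≤ _ := by
              rw [mul_pow]
              gcongr⟩
      (fun z => by positivity) ⟨b, hb, fun z => hS z.1 z.2⟩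
    refine ⟨c, hc, fun x y z => ?_⟩
    have key := h x (y, z)
    rw [comp_apply, coprod_apply, inner_map_add_ringInverse p₁.isUnit a₁₁] at key
    simp only [comp_apply, sub_apply, inner_add_left, inner_sub_left, map_add, inner_add_right,
      a₂₁, a₃₁, a₃₂, hinv] at key
    simp only [inner_add_left, a₂₁, a₃₁, a₃₂]
    linarith [real_inner_comm x (B₁₂ y), real_inner_comm x (B₁₃ z)]
end
end

section
/- Let V : ℕ → ℕ satisfy the recursion V(1) = 1, V(2n) = 4·V(n) and V(2n+1) = 2·(V(n) + V(n+1)) for all n ≥ 1. Then for every k ∈ ℕ (including k = 0) and every n with 2^k ≤ n ≤ 2^{k+1}, one has V(n) = 2^k·(3n − 2^{k+1}). -/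
theorem statement3 (V : ℕ → ℕ) (hV1 : V 1 = 1)
    (hVeven : ∀ n : ℕ, 1 ≤ n → V (2 * n) = 4 * V n)
    (hVodd : ∀ n : ℕ, 1 ≤ n → V (2 * n + 1) = 2 * (V n + V (n + 1))) :
    ∀ (k n : ℕ), 2 ^ k ≤ n → n ≤ 2 ^ (k + 1) →
      V n = 2 ^ k * (3 * n - 2 ^ (k + 1)) := by
  intro k
  induction k with
  | zero =>
    intro n hlo hhi
    have hV2 := hVeven 1 le_rfl
    interval_cases n <;> simp_all
  | succ k ih =>
    intro n hlo hhi
    have hpos : 0 < 2 ^ k := by positivity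
    simp only [pow_succ] at ih hlo hhi ⊢
    generalize 2 ^ k = p at *
    obtain ⟨m, rfl | rfl⟩ := n.even_or_odd'
    · rw [hVeven m (by omega), ih m (by omega) (by omega),
        show 3 * (2 * m) - p * 2 * 2 = 2 * (3 * m - p * 2) by omega]
      ring
    · rw [hVodd m (by omega), ih m (by omega) (by omega), ih (m + 1) (by omega) (by omega),
        ← mul_add,
        show 3 * (2 * m + 1) - p * 2 * 2 = 3 * m - p * 2 + (3 * (m + 1) - p * 2) by omega]
      ring
end

section
/- Let H₁, H₂, H₃ be real Hilbert spaces and let B = (B_{ij})_{i,j=1}^3 be a self-adjoint continuous linear operator matrix on H₁ × H₂ × H₃ (B_{ij}* = B_{ji}). Suppose that B₁₁ and Δ₁²² := B₂₂ − B₂₁·B₁₁⁻¹·B₁₂ are continuously invertible. Define Δ₁^{ik} := B_{ik} − B_{i1}·B₁₁⁻¹·B_{1k} for i,k ∈ {2,3}. Then B is nonnegative if and only if B₁₁ ≥ 0, Δ₁²² ≥ 0, and Δ₁³³ − Δ₁³²·(Δ₁²²)⁻¹·Δ₁²³ ≥ 0. -/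
open ContinuousLinearMap RealInnerProductSpace

noncomputable section

/-- A continuous linear operator `B` on a real Hilbert space is *nonnegative*
(`B ≥ 0`) if `⟪B h, h⟫ ≥ 0` for all `h`. -/
def IsNonnegOp {H : Type*} [NormedAddCommGroup H] [InnerProductSpace ℝ H]
    (B : H →L[ℝ] H) : Prop :=
  ∀ h : H, 0 ≤ ⟪B h, h⟫

section CompleteSquare

variable {H : Type*} [NormedAddCommGroup H] [InnerProductSpace ℝ H]

theorem apply_ringInverse_apply {A : H →L[ℝ] H} (hu : IsUnit A) (w : H) :
    A (Ring.inverse A w) = w :=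
  DFunLike.congr_fun (Ring.mul_inverse_cancel A hu) w

variable [CompleteSpace H]

theorem adjoint_ringInverse {A : H →L[ℝ] H} (hA : adjoint A = A) :
    adjoint (Ring.inverse A) = Ring.inverse A := by
  rw [← star_eq_adjoint, ← Ring.inverse_star, star_eq_adjoint, hA]

theorem inner_complete_square {A : H →L[ℝ] H} (hA : adjoint A = A) (hu : IsUnit A) (x w : H) :
    ⟪A x, x⟫ + 2 * ⟪w, x⟫ =
      ⟪A (x + Ring.inverse A w), x + Ring.inverse A w⟫ - ⟪w, Ring.inverse A w⟫ := by
  have h : ⟪A x, Ring.inverse A w⟫ = ⟪w, x⟫ := by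
    rw [← adjoint_inner_right, hA, apply_ringInverse_apply hu, real_inner_comm]
  simp only [map_add, apply_ringInverse_apply hu, inner_add_left, inner_add_right, h]
  ring

end CompleteSquare

theorem statement8
    {H₁ H₂ H₃ : Type*}
    [NormedAddCommGroup H₁] [InnerProductSpace ℝ H₁] [CompleteSpace H₁]
    [NormedAddCommGroup H₂] [InnerProductSpace ℝ H₂] [CompleteSpace H₂]
    [NormedAddCommGroup H₃] [InnerProductSpace ℝ H₃] [CompleteSpace H₃]
    (B₁₁ : H₁ →L[ℝ] H₁) (B₁₂ : H₂ →L[ℝ] H₁) (B₁₃ : H₃ →L[ℝ] H₁)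
    (B₂₁ : H₁ →L[ℝ] H₂) (B₂₂ : H₂ →L[ℝ] H₂) (B₂₃ : H₃ →L[ℝ] H₂)
    (B₃₁ : H₁ →L[ℝ] H₃) (B₃₂ : H₂ →L[ℝ] H₃) (B₃₃ : H₃ →L[ℝ] H₃)
    (h₁₁ : adjoint B₁₁ = B₁₁) (h₂₂ : adjoint B₂₂ = B₂₂) (h₃₃ : adjoint B₃₃ = B₃₃)
    (h₁₂ : adjoint B₁₂ = B₂₁) (h₁₃ : adjoint B₁₃ = B₃₁) (h₂₃ : adjoint B₂₃ = B₃₂)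
    (h₁₁inv : IsUnit B₁₁)
    (hΔinv : IsUnit (B₂₂ - B₂₁ ∘L Ring.inverse B₁₁ ∘L B₁₂)) :
    -- the operator matrix `B` is nonnegative on `H₁ × H₂ × H₃` (ℓ²-product)
    (∀ (h₁ : H₁) (h₂ : H₂) (h₃ : H₃),
        0 ≤ ⟪B₁₁ h₁ + B₁₂ h₂ + B₁₃ h₃, h₁⟫ + ⟪B₂₁ h₁ + B₂₂ h₂ + B₂₃ h₃, h₂⟫ +
          ⟪B₃₁ h₁ + B₃₂ h₂ + B₃₃ h₃, h₃⟫) ↔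
      (IsNonnegOp B₁₁ ∧
        IsNonnegOp (B₂₂ - B₂₁ ∘L Ring.inverse B₁₁ ∘L B₁₂) ∧
        IsNonnegOp ((B₃₃ - B₃₁ ∘L Ring.inverse B₁₁ ∘L B₁₃) -
          (B₃₂ - B₃₁ ∘L Ring.inverse B₁₁ ∘L B₁₂) ∘L
            Ring.inverse (B₂₂ - B₂₁ ∘L Ring.inverse B₁₁ ∘L B₁₂) ∘L
              (B₂₃ - B₂₁ ∘L Ring.inverse B₁₁ ∘L B₁₃))) := by
  set R := Ring.inverse B₁₁ with hR
  have hRadj : adjoint R = R := adjoint_ringInverse h₁₁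
  set D₂₂ := B₂₂ - B₂₁ ∘L R ∘L B₁₂ with hD₂₂
  set D₂₃ := B₂₃ - B₂₁ ∘L R ∘L B₁₃ with hD₂₃
  set D₃₂ := B₃₂ - B₃₁ ∘L R ∘L B₁₂ with hD₃₂
  set S := B₃₃ - B₃₁ ∘L R ∘L B₁₃ - D₃₂ ∘L Ring.inverse D₂₂ ∘L D₂₃ with hS
  have h₂₁ : adjoint B₂₁ = B₁₂ := by rw [← h₁₂, adjoint_adjoint]
  have hD₂₂adj : adjoint D₂₂ = D₂₂ := by
    simp only [hD₂₂, map_sub, adjoint_comp, h₂₂, h₁₂, h₂₁, hRadj, comp_assoc]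
  have hD₂₃adj : adjoint D₂₃ = D₃₂ := by
    simp only [hD₂₃, hD₃₂, map_sub, adjoint_comp, h₂₃, h₁₃, h₂₁, hRadj, comp_assoc]
  have key (x : H₁) (y : H₂) (z : H₃) :
      ⟪B₁₁ x + B₁₂ y + B₁₃ z, x⟫ + ⟪B₂₁ x + B₂₂ y + B₂₃ z, y⟫ +
          ⟪B₃₁ x + B₃₂ y + B₃₃ z, z⟫ =
        ⟪B₁₁ (x + R (B₁₂ y + B₁₃ z)), x + R (B₁₂ y + B₁₃ z)⟫ +
          ⟪D₂₂ (y + Ring.inverse D₂₂ (D₂₃ z)), y + Ring.inverse D₂₂ (D₂₃ z)⟫ + ⟪S z, z⟫ := by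
    have e₁ := inner_complete_square h₁₁ h₁₁inv x (B₁₂ y + B₁₃ z)
    have e₂ := inner_complete_square hD₂₂adj hΔinv y (D₂₃ z)
    rw [← hR] at e₁
    have e₃ : ⟪D₃₂ (Ring.inverse D₂₂ (D₂₃ z)), z⟫ = ⟪D₂₃ z, Ring.inverse D₂₂ (D₂₃ z)⟫ := by
      rw [← hD₂₃adj, adjoint_inner_left, real_inner_comm]
    have e₄ : ⟪S z, z⟫ = ⟪B₃₃ z, z⟫ - ⟪R (B₁₃ z), B₁₃ z⟫ -
        ⟪D₂₃ z, Ring.inverse D₂₂ (D₂₃ z)⟫ := by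
      rw [← e₃, hS, ← h₁₃]
      simp only [sub_apply, comp_apply, inner_sub_left, adjoint_inner_left]
    have e₅ : ⟪D₂₂ y, y⟫ = ⟪B₂₂ y, y⟫ - ⟪R (B₁₂ y), B₁₂ y⟫ := by
      rw [hD₂₂, ← h₁₂]
      simp only [sub_apply, comp_apply, inner_sub_left, adjoint_inner_left]
    have e₆ : ⟪D₂₃ z, y⟫ = ⟪B₂₃ z, y⟫ - ⟪R (B₁₃ z), B₁₂ y⟫ := by
      rw [hD₂₃, ← h₁₂]
      simp only [sub_apply, comp_apply, inner_sub_left, adjoint_inner_left]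
    have e₇ : ⟪B₁₂ y + B₁₃ z, R (B₁₂ y + B₁₃ z)⟫ =
        ⟪R (B₁₂ y), B₁₂ y⟫ + 2 * ⟪R (B₁₃ z), B₁₂ y⟫ + ⟪R (B₁₃ z), B₁₃ z⟫ := by
      have : ⟪R (B₁₂ y), B₁₃ z⟫ = ⟪R (B₁₃ z), B₁₂ y⟫ := by
        rw [← adjoint_inner_right, hRadj, real_inner_comm]
      rw [real_inner_comm]
      simp only [map_add, inner_add_left, inner_add_right, this]
      ring
    have f₁ : ⟪B₂₁ x, y⟫ = ⟪B₁₂ y, x⟫ := by rw [← h₁₂, adjoint_inner_left, real_inner_comm]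
    have f₂ : ⟪B₃₁ x, z⟫ = ⟪B₁₃ z, x⟫ := by rw [← h₁₃, adjoint_inner_left, real_inner_comm]
    have f₃ : ⟪B₃₂ y, z⟫ = ⟪B₂₃ z, y⟫ := by rw [← h₂₃, adjoint_inner_left, real_inner_comm]
    rw [inner_add_left (B₁₂ y)] at e₁
    simp only [inner_add_left (B₁₁ x + _), inner_add_left (B₁₁ x), inner_add_left (B₂₁ x + _),
      inner_add_left (B₂₁ x), inner_add_left (B₃₁ x + _), inner_add_left (B₃₁ x), f₁, f₂, f₃]
    linarith
  refine ⟨fun h => ⟨fun x => ?_, fun y => ?_, fun z => ?_⟩, fun ⟨hx, hy, hz⟩ x y z => ?_⟩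
  · simpa using h x 0 0
  · have := h (-R (B₁₂ y)) y 0
    rw [key] at this
    simpa using this
  · have := h (-R (B₁₂ (-Ring.inverse D₂₂ (D₂₃ z)) + B₁₃ z)) (-Ring.inverse D₂₂ (D₂₃ z)) z
    rw [key, neg_add_cancel, neg_add_cancel] at this
    simpa using this
  · rw [key]
    exact add_nonneg (add_nonneg (hx _) (hy _)) (hz _)
end
end

section
/- Let H₁, H₂ be real Hilbert spaces and let B = (B_{ij})_{i,j=1}^2 be a self-adjoint continuous linear operator matrix on H₁ × H₂ (B₁₁* = B₁₁, B₂₂* = B₂₂, B₁₂* = B₂₁) such that all four operators B₁₁, B₁₂, B₂₁, B₂₂ pairwise commute (where composites are defined). Then B is positive definite if and only if B₁₁ ≫ 0 and B₁₁·B₂₂ − B₁₂·B₂₁ ≫ 0. -/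
open ContinuousLinearMap RealInnerProductSpace

noncomputable section

/-- A symmetric operator with nonnegative quadratic form satisfies
`‖R x‖² ≤ (‖R‖ + 1) ⟪R x, x⟫`. -/
theorem norm_sq_apply_le_of_symmetric_of_nonneg {H : Type*} [NormedAddCommGroup H]
    [InnerProductSpace ℝ H] (R : H →L[ℝ] H) (hsymm : ∀ x y, ⟪R x, y⟫ = ⟪x, R y⟫)
    (hnonneg : ∀ x, 0 ≤ ⟪R x, x⟫) (x : H) :
    ‖R x‖ ^ 2 ≤ (‖R‖ + 1) * ⟪R x, x⟫ := by
  have hk : 0 < ‖R‖ + 1 := by positivity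
  have hpos := hnonneg ((‖R‖ + 1) • x - R x)
  have hRR : ⟪R (R x), R x⟫ ≤ ‖R‖ * ‖R x‖ ^ 2 := by
    calc ⟪R (R x), R x⟫ ≤ ‖R (R x)‖ * ‖R x‖ := real_inner_le_norm _ _
      _ ≤ ‖R‖ * ‖R x‖ * ‖R x‖ := by gcongr; exact R.le_opNorm _
      _ = ‖R‖ * ‖R x‖ ^ 2 := by ring
  have hxx : ⟪R (R x), x⟫ = ‖R x‖ ^ 2 := by
    rw [hsymm, real_inner_self_eq_norm_sq]
  simp only [map_sub, map_smul, inner_sub_left, inner_sub_right, real_inner_smul_left,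
    real_inner_smul_right, real_inner_self_eq_norm_sq, hxx] at hpos
  have hmul : (‖R‖ + 1) * ‖R x‖ ^ 2 ≤ (‖R‖ + 1) * ((‖R‖ + 1) * ⟪R x, x⟫) := by
    nlinarith [sq_nonneg ‖R x‖]
  exact le_of_mul_le_mul_left hmul hk

/-- If `S` is symmetric, `A` has nonnegative quadratic form and `⟪S x, A x⟫ ≥ d‖x‖²` with
`d > 0`, then `S` is positive definite: `S + s` is bounded below uniformly in `s ≥ 0`, so the
least `s ≥ 0` making it nonnegative is `0`. -/
theorem isPosDef_of_le_inner_apply {H : Type*} [NormedAddCommGroup H]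
    [InnerProductSpace ℝ H] (S A : H →L[ℝ] H) (hS : ∀ x y, ⟪S x, y⟫ = ⟪x, S y⟫)
    (hA : ∀ x, 0 ≤ ⟪A x, x⟫) {d : ℝ} (hd : 0 < d)
    (hSA : ∀ x, d * ‖x‖ ^ 2 ≤ ⟪S x, A x⟫) : IsPosDef S := by
  set T : Set ℝ := {s | 0 ≤ s ∧ ∀ x, 0 ≤ ⟪S x, x⟫ + s * ‖x‖ ^ 2} with hT
  have hclosed : IsClosed T := by
    simp only [hT, Set.ofPred_and, Set.ofPred_forall]
    refine isClosed_Ici.inter (isClosed_iInter fun x => ?_)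
    exact isClosed_le continuous_const (by fun_prop)
  have hne : T.Nonempty := by
    refine ⟨‖S‖, norm_nonneg _, fun x => ?_⟩
    have habs := (abs_le.mp (abs_real_inner_le_norm (S x) x)).1
    nlinarith [mul_le_mul_of_nonneg_right (S.le_opNorm x) (norm_nonneg x)]
  have hbdd : BddBelow T := ⟨0, fun s hs => hs.1⟩
  obtain ⟨hs₀, hs⟩ := hclosed.csInf_mem hne hbdd
  set s₀ := sInf T with hs₀_def
  set R : H →L[ℝ] H := S + s₀ • ContinuousLinearMap.id ℝ H with hR
  have hRx : ∀ x, R x = S x + s₀ • x := fun x => by simp [hR]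
  have hRinner : ∀ x, ⟪R x, x⟫ = ⟪S x, x⟫ + s₀ * ‖x‖ ^ 2 := fun x => by
    rw [hRx, inner_add_left, real_inner_smul_left, real_inner_self_eq_norm_sq]
  have hRsymm : ∀ x y, ⟪R x, y⟫ = ⟪x, R y⟫ := fun x y => by
    simp only [hRx, inner_add_left, inner_add_right, real_inner_smul_left,
      real_inner_smul_right, hS]
  have hRnonneg : ∀ x, 0 ≤ ⟪R x, x⟫ := fun x => (hRinner x).symm ▸ hs x
  have hlower : ∀ x, d * ‖x‖ ≤ ‖A‖ * ‖R x‖ := fun x => by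
    rcases (norm_nonneg x).eq_or_lt with h0 | hpos
    · rw [← h0, mul_zero]; positivity
    refine le_of_mul_le_mul_right ?_ hpos
    calc d * ‖x‖ * ‖x‖ = d * ‖x‖ ^ 2 := by ring
      _ ≤ ⟪S x, A x⟫ + s₀ * ⟪A x, x⟫ := by nlinarith [hSA x, mul_nonneg hs₀ (hA x)]
      _ = ⟪R x, A x⟫ := by
        rw [hRx, inner_add_left, real_inner_smul_left, real_inner_comm x (A x)]
      _ ≤ ‖R x‖ * ‖A x‖ := real_inner_le_norm _ _
      _ ≤ ‖R x‖ * (‖A‖ * ‖x‖) := by gcongr; exact A.le_opNorm _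
      _ = ‖A‖ * ‖R x‖ * ‖x‖ := by ring
  set K : ℝ := ‖A‖ ^ 2 * (‖R‖ + 1) + 1 with hK
  have hKpos : 0 < K := by positivity
  have hε : 0 < d ^ 2 / K := by positivity
  have hbound : ∀ x, d ^ 2 / K * ‖x‖ ^ 2 ≤ ⟪S x, x⟫ + s₀ * ‖x‖ ^ 2 := fun x => by
    rw [← hRinner, div_mul_eq_mul_div, div_le_iff₀ hKpos]
    calc d ^ 2 * ‖x‖ ^ 2 = (d * ‖x‖) ^ 2 := by ring
      _ ≤ (‖A‖ * ‖R x‖) ^ 2 :=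
        pow_le_pow_left₀ (by positivity) (hlower x) 2
      _ = ‖A‖ ^ 2 * ‖R x‖ ^ 2 := by ring
      _ ≤ ‖A‖ ^ 2 * ((‖R‖ + 1) * ⟪R x, x⟫) := by
        gcongr; exact norm_sq_apply_le_of_symmetric_of_nonneg R hRsymm hRnonneg x
      _ ≤ ⟪R x, x⟫ * K := by rw [hK]; nlinarith [hRnonneg x]
  have hzero : s₀ = 0 := by
    by_contra hne0
    have hs₀pos : 0 < s₀ := lt_of_le_of_ne hs₀ (Ne.symm hne0)
    have hmem : max 0 (s₀ - d ^ 2 / K) ∈ T := by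
      refine ⟨le_max_left _ _, fun x => ?_⟩
      have := mul_le_mul_of_nonneg_right (le_max_right 0 (s₀ - d ^ 2 / K)) (sq_nonneg ‖x‖)
      linarith [hbound x]
    exact absurd (csInf_le hbdd hmem) (not_le.mpr (max_lt hs₀pos (by linarith)))
  refine ⟨d ^ 2 / K, hε, fun x => ?_⟩
  simpa [hzero] using hbound x

/-- A positive definite operator is bounded below. -/
theorem mul_norm_le_norm_apply_of_le_inner {H : Type*} [NormedAddCommGroup H]
    [InnerProductSpace ℝ H] (A : H →L[ℝ] H) {a : ℝ} (hA : ∀ x, a * ‖x‖ ^ 2 ≤ ⟪A x, x⟫) (x : H) :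
    a * ‖x‖ ≤ ‖A x‖ := by
  rcases (norm_nonneg x).eq_or_lt with h0 | hpos
  · rw [← h0, mul_zero]; positivity
  refine le_of_mul_le_mul_right ?_ hpos
  calc a * ‖x‖ * ‖x‖ = a * ‖x‖ ^ 2 := by ring
    _ ≤ ⟪A x, x⟫ := hA x
    _ ≤ ‖A x‖ * ‖x‖ := real_inner_le_norm _ _

/-- A positive definite operator on a Hilbert space is surjective. -/
theorem IsPosDef.surjective {H : Type*} [NormedAddCommGroup H] [InnerProductSpace ℝ H]
    [CompleteSpace H] {A : H →L[ℝ] H} (hA : IsPosDef A) : Function.Surjective A := by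
  obtain ⟨a, ha, hA⟩ := hA
  have hunit : IsUnit A := by
    refine A.isUnit_of_forall_le_norm_inner_map (c := ⟨a, ha.le⟩) ha fun x => ?_
    rw [Real.norm_eq_abs]
    refine le_trans (le_of_eq ?_) ((hA x).trans (le_abs_self _))
    exact mul_comm _ _
  exact (ContinuousLinearMap.isUnit_iff_bijective.mp hunit).2

/-- For the commutativity hypothesis (every two of `B₁₁, B₁₂, B₂₁, B₂₂` commute
whenever both orders of composition are defined) to be meaningful, all entries act
on one and the same Hilbert space `H`, over which the operator matrix acts on
`H × H`; the Schur criterion then reduces to the Sylvester condition. -/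
theorem statement12
    {H : Type*} [NormedAddCommGroup H] [InnerProductSpace ℝ H] [CompleteSpace H]
    (B₁₁ B₁₂ B₂₁ B₂₂ : H →L[ℝ] H)
    (h₁₁ : adjoint B₁₁ = B₁₁) (h₂₂ : adjoint B₂₂ = B₂₂)
    (h₁₂ : adjoint B₁₂ = B₂₁)
    (c₁ : Commute B₁₁ B₁₂) (c₂ : Commute B₁₁ B₂₁) (c₃ : Commute B₁₁ B₂₂)
    (c₄ : Commute B₁₂ B₂₁) (c₅ : Commute B₁₂ B₂₂) (c₆ : Commute B₂₁ B₂₂) :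
    -- the operator matrix `B` is positive definite on `H × H` (ℓ²-product)
    (∃ c > 0, ∀ h₁ h₂ : H,
        c * (‖h₁‖ ^ 2 + ‖h₂‖ ^ 2) ≤
          ⟪B₁₁ h₁ + B₁₂ h₂, h₁⟫ + ⟪B₂₁ h₁ + B₂₂ h₂, h₂⟫) ↔
      (IsPosDef B₁₁ ∧ IsPosDef (B₁₁ ∘L B₂₂ - B₁₂ ∘L B₂₁)) := by
  have sA : ∀ x y, ⟪B₁₁ x, y⟫ = ⟪x, B₁₁ y⟫ := fun x y => by
    rw [← adjoint_inner_right, h₁₁]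
  have sD : ∀ x y, ⟪B₂₂ x, y⟫ = ⟪x, B₂₂ y⟫ := fun x y => by
    rw [← adjoint_inner_right, h₂₂]
  have sC : ∀ x y, ⟪B₁₂ x, y⟫ = ⟪x, B₂₁ y⟫ := fun x y => by
    rw [← adjoint_inner_right, h₁₂]
  have sC' : ∀ x y, ⟪B₂₁ x, y⟫ = ⟪x, B₁₂ y⟫ := fun x y => by
    rw [← h₁₂, adjoint_inner_left]
  have e₁ : ∀ x, B₁₂ (B₁₁ x) = B₁₁ (B₁₂ x) := fun x => (DFunLike.congr_fun c₁.eq x).symm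
  have e₂ : ∀ x, B₂₁ (B₁₁ x) = B₁₁ (B₂₁ x) := fun x => (DFunLike.congr_fun c₂.eq x).symm
  have e₃ : ∀ x, B₂₂ (B₁₁ x) = B₁₁ (B₂₂ x) := fun x => (DFunLike.congr_fun c₃.eq x).symm
  have e₄ : ∀ x, B₂₁ (B₁₂ x) = B₁₂ (B₂₁ x) := fun x => (DFunLike.congr_fun c₄.eq x).symm
  set S : H →L[ℝ] H := B₁₁ ∘L B₂₂ - B₁₂ ∘L B₂₁ with hS
  have hSx : ∀ x, S x = B₁₁ (B₂₂ x) - B₁₂ (B₂₁ x) := fun x => by simp [hS]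
  have sS : ∀ x y, ⟪S x, y⟫ = ⟪x, S y⟫ := fun x y => by
    simp only [hSx, inner_sub_left, inner_sub_right, sA, sD, sC, sC', e₃]
  have eS : ∀ x, S (B₁₁ x) = B₁₁ (S x) := fun x => by
    simp only [hSx, map_sub, e₁, e₂, e₃]
  constructor
  · rintro ⟨c, hc, hB⟩
    have hA : ∀ x, c * ‖x‖ ^ 2 ≤ ⟪B₁₁ x, x⟫ := fun x => by simpa using hB x 0
    refine ⟨⟨c, hc, hA⟩, ?_⟩
    refine isPosDef_of_le_inner_apply S B₁₁ sS
      (fun x => (by positivity : (0 : ℝ) ≤ c * ‖x‖ ^ 2).trans (hA x))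
      (d := c * c ^ 2) (by positivity) fun x => ?_
    have hx := hB (-(B₁₂ x)) (B₁₁ x)
    have hfst : B₁₁ (-(B₁₂ x)) + B₁₂ (B₁₁ x) = 0 := by rw [e₁, map_neg, neg_add_cancel]
    have hsnd : B₂₁ (-(B₁₂ x)) + B₂₂ (B₁₁ x) = S x := by
      rw [hSx, map_neg, e₄, e₃]; abel
    rw [hfst, hsnd, inner_zero_left, zero_add] at hx
    refine le_trans ?_ hx
    have hlow : (c * ‖x‖) ^ 2 ≤ ‖B₁₁ x‖ ^ 2 := by
      gcongr; exact mul_norm_le_norm_apply_of_le_inner B₁₁ hA x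
    calc c * c ^ 2 * ‖x‖ ^ 2 = c * (c * ‖x‖) ^ 2 := by ring
      _ ≤ c * (‖-(B₁₂ x)‖ ^ 2 + ‖B₁₁ x‖ ^ 2) := by
        gcongr; linarith [sq_nonneg ‖-(B₁₂ x)‖]
  · rintro ⟨hApos, s, hs, hSpos⟩
    have hsurj := hApos.surjective
    obtain ⟨a, ha, hA⟩ := hApos
    have hAS : IsPosDef (B₁₁ ∘L S) := by
      refine isPosDef_of_le_inner_apply (B₁₁ ∘L S) B₁₁ (fun x y => ?_)
        (fun x => (by positivity : (0 : ℝ) ≤ a * ‖x‖ ^ 2).trans (hA x))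
        (d := s * a ^ 2) (by positivity) fun x => ?_
      · simp only [ContinuousLinearMap.comp_apply]
        rw [sA, sS, eS]
      · have hlow : (a * ‖x‖) ^ 2 ≤ ‖B₁₁ x‖ ^ 2 := by
          gcongr; exact mul_norm_le_norm_apply_of_le_inner B₁₁ hA x
        rw [ContinuousLinearMap.comp_apply, ← eS]
        calc s * a ^ 2 * ‖x‖ ^ 2 = s * (a * ‖x‖) ^ 2 := by ring
          _ ≤ s * ‖B₁₁ x‖ ^ 2 := by gcongr
          _ ≤ ⟪S (B₁₁ x), B₁₁ x⟫ := hSpos _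
    obtain ⟨t, ht, hAS⟩ := hAS
    set M : ℝ := 2 * ‖B₁₂‖ ^ 2 + ‖B₁₁‖ ^ 2 + 2 with hM
    have hMpos : 0 < M := by positivity
    refine ⟨min a t / M, by positivity, fun h₁ h₂ => ?_⟩
    obtain ⟨x, rfl⟩ := hsurj h₂
    obtain ⟨y, rfl⟩ : ∃ y, h₁ = y - B₁₂ x := ⟨h₁ + B₁₂ x, by abel⟩
    have hform : ⟪B₁₁ (y - B₁₂ x) + B₁₂ (B₁₁ x), y - B₁₂ x⟫ +
        ⟪B₂₁ (y - B₁₂ x) + B₂₂ (B₁₁ x), B₁₁ x⟫ = ⟪B₁₁ y, y⟫ + ⟪B₁₁ (S x), x⟫ := by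
      have hfst : B₁₁ (y - B₁₂ x) + B₁₂ (B₁₁ x) = B₁₁ y := by
        rw [e₁, map_sub, sub_add_cancel]
      have hsnd : B₂₁ (y - B₁₂ x) + B₂₂ (B₁₁ x) = B₂₁ y + S x := by
        rw [hSx, map_sub, e₄, e₃]; abel
      rw [hfst, hsnd, inner_sub_right, inner_add_left, sC', e₁, sA y (B₁₂ x), sA (S x) x]
      ring
    rw [hform, div_mul_eq_mul_div, div_le_iff₀ hMpos]
    have hASx : t * ‖x‖ ^ 2 ≤ ⟪B₁₁ (S x), x⟫ := hAS x
    have hm : 0 < min a t := lt_min ha ht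
    have hlow : min a t * (‖y‖ ^ 2 + ‖x‖ ^ 2) ≤ ⟪B₁₁ y, y⟫ + ⟪B₁₁ (S x), x⟫ := by
      have hy := mul_le_mul_of_nonneg_right (min_le_left a t) (sq_nonneg ‖y‖)
      have hx := mul_le_mul_of_nonneg_right (min_le_right a t) (sq_nonneg ‖x‖)
      linarith [hA y]
    have hup : ‖y - B₁₂ x‖ ^ 2 + ‖B₁₁ x‖ ^ 2 ≤ (‖y‖ ^ 2 + ‖x‖ ^ 2) * M := by
      have hy : ‖y - B₁₂ x‖ ^ 2 ≤ (‖y‖ + ‖B₁₂‖ * ‖x‖) ^ 2 := by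
        gcongr
        exact (norm_sub_le _ _).trans (by gcongr; exact B₁₂.le_opNorm x)
      have hx : ‖B₁₁ x‖ ^ 2 ≤ (‖B₁₁‖ * ‖x‖) ^ 2 := by gcongr; exact B₁₁.le_opNorm x
      have hy₀ : 0 ≤ ‖y‖ ^ 2 * (2 * ‖B₁₂‖ ^ 2 + ‖B₁₁‖ ^ 2) := by positivity
      rw [hM]
      nlinarith [sq_nonneg (‖y‖ - ‖B₁₂‖ * ‖x‖), sq_nonneg ‖x‖]
    calc min a t * (‖y - B₁₂ x‖ ^ 2 + ‖B₁₁ x‖ ^ 2)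
        ≤ min a t * ((‖y‖ ^ 2 + ‖x‖ ^ 2) * M) := by gcongr
      _ = min a t * (‖y‖ ^ 2 + ‖x‖ ^ 2) * M := by ring
      _ ≤ (⟪B₁₁ y, y⟫ + ⟪B₁₁ (S x), x⟫) * M := by gcongr
end
end

section
/- Let H₁, H₂ be real Hilbert spaces and let Φ : H₁ × H₂ → ℝ be twice Fréchet differentiable at a point y = (y₁, y₂) ∈ H₁ × H₂. Suppose that (i) ∂₁Φ(y) = 0 and ∂₂Φ(y) = 0; (ii) ∂₁₁Φ(y) ≫ 0 and ∂₂₂Φ(y) ≫ 0 (so both are continuously invertible); and (iii) ∂₁₁Φ(y) − ∂₁₂Φ(y)·(∂₂₂Φ(y))⁻¹·∂₂₁Φ(y) ≫ 0 and ∂₂₂Φ(y) − ∂₂₁Φ(y)·(∂₁₁Φ(y))⁻¹·∂₁₂Φ(y) ≫ 0. Then Φ has a strong local minimum at y, i.e. there is a neighborhood U of y with Φ(x) > Φ(y) for all x ∈ U, x ≠ y. -/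
open ContinuousLinearMap RealInnerProductSpace Filter Topology

noncomputable section

theorem IsPosDef.isUnit_s13 {H : Type*} [NormedAddCommGroup H] [InnerProductSpace ℝ H]
    [CompleteSpace H] {B : H →L[ℝ] H} (hB : IsPosDef B) : IsUnit B := by
  obtain ⟨c, hc, h⟩ := hB
  refine isUnit_of_forall_le_norm_inner_map B (c := ⟨c, hc.le⟩) hc fun x ↦ ?_
  have := h x
  rw [mul_comm] at this
  exact this.trans (le_abs_self _)

/-- Completing the square: if `D ≥ 0` is symmetric and invertible, the quadratic form of the
block operator `(A, C*; C, D)` dominates that of the Schur complement `A - C* D⁻¹ C`. -/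
theorem inner_schurComplement_le {E F : Type*}
    [NormedAddCommGroup E] [InnerProductSpace ℝ E] [NormedAddCommGroup F] [InnerProductSpace ℝ F]
    {A : E →L[ℝ] E} {B : F →L[ℝ] E} {C : E →L[ℝ] F} {D : F →L[ℝ] F}
    (hBC : ∀ u v, ⟪B v, u⟫ = ⟪C u, v⟫) (hD : ∀ v w, ⟪D v, w⟫ = ⟪D w, v⟫)
    (hD_nonneg : ∀ v, 0 ≤ ⟪D v, v⟫) (hD_unit : IsUnit D) (u : E) (v : F) :
    ⟪(A - B ∘L Ring.inverse D ∘L C) u, u⟫ ≤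
      ⟪A u, u⟫ + ⟪B v, u⟫ + ⟪C u, v⟫ + ⟪D v, v⟫ := by
  set w := Ring.inverse D (C u) with hw
  have hDw : D w = C u := by
    exact DFunLike.congr_fun (Ring.mul_inverse_cancel D hD_unit) (C u)
  have hsq := hD_nonneg (v + w)
  have hvw : ⟪D v, w⟫ = ⟪C u, v⟫ := by rw [hD, hDw]
  simp only [map_add, inner_add_left, inner_add_right, hDw, hvw] at hsq
  simp only [sub_apply, comp_apply, inner_sub_left, ← hw, hBC]
  linarith

/-- Second-order sufficient condition for a strict local minimum. -/
theorem eventually_lt_of_coercive_second_derivative {E : Type*} [NormedAddCommGroup E]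
    [NormedSpace ℝ E] {f : E → ℝ} {f' : E → E →L[ℝ] ℝ} {f'' : E →L[ℝ] E →L[ℝ] ℝ} {y : E}
    (hf : ∀ᶠ x in 𝓝 y, HasFDerivAt f (f' x) x) (hf' : HasFDerivAt f' f'' y)
    (hy : f' y = 0) {c : ℝ} (hc : 0 < c) (hcoer : ∀ h, c * ‖h‖ ^ 2 ≤ f'' h h) :
    ∀ᶠ x in 𝓝 y, x ≠ y → f y < f x := by
  have hlin := hf'.isLittleO.def (half_pos hc)
  obtain ⟨r, hr, hball⟩ := Metric.eventually_nhds_iff_ball.1 (hf.and hlin)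
  filter_upwards [Metric.ball_mem_nhds y hr] with x hx hxy
  set h := x - y with hh
  have hh0 : 0 < ‖h‖ := norm_pos_iff.2 (sub_ne_zero.2 hxy)
  have hmem : ∀ t ∈ Set.Icc (0 : ℝ) 1, y + t • h ∈ Metric.ball y r := fun t ht ↦
    (convex_ball y r).add_smul_sub_mem (Metric.mem_ball_self hr) hx ht
  have hderiv : ∀ t ∈ Set.Icc (0 : ℝ) 1,
      HasDerivAt (fun s : ℝ ↦ f (y + s • h)) (f' (y + t • h) h) t := fun t ht ↦ by
    have hline : HasDerivAt (fun s : ℝ ↦ y + s • h) h t := by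
      simpa using ((hasDerivAt_id t).smul_const h).const_add y
    exact (hball _ (hmem t ht)).1.comp_hasDerivAt t hline
  have hmono : StrictMonoOn (fun s : ℝ ↦ f (y + s • h)) (Set.Icc 0 1) := by
    refine strictMonoOn_of_deriv_pos (convex_Icc 0 1)
      (fun t ht ↦ (hderiv t ht).continuousAt.continuousWithinAt) fun t ht ↦ ?_
    rw [interior_Icc] at ht
    have ht' := Set.Ioo_subset_Icc_self ht
    rw [(hderiv t ht').deriv]
    have hrem := (hball _ (hmem t ht')).2
    rw [hy, sub_zero, add_sub_cancel_left, norm_smul, Real.norm_of_nonneg ht.1.le] at hrem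
    have happ := (le_opNorm (f' (y + t • h) - f'' (t • h)) h).trans
      (mul_le_mul_of_nonneg_right hrem hh0.le)
    rw [sub_apply, map_smul, smul_apply, smul_eq_mul, Real.norm_eq_abs] at happ
    have hlow := (abs_le.1 happ).1
    have hquad := mul_le_mul_of_nonneg_left (hcoer h) ht.1.le
    have hpos : 0 < t * (c * ‖h‖ ^ 2) := mul_pos ht.1 (by positivity)
    linarith
  simpa [hh] using hmono (Set.left_mem_Icc.2 zero_le_one) (Set.right_mem_Icc.2 zero_le_one)
    zero_lt_one

theorem statement13
    {H₁ H₂ : Type*}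
    [NormedAddCommGroup H₁] [InnerProductSpace ℝ H₁] [CompleteSpace H₁]
    [NormedAddCommGroup H₂] [InnerProductSpace ℝ H₂] [CompleteSpace H₂]
    (Φ : H₁ × H₂ → ℝ) (y : H₁ × H₂)
    -- `Φ` is twice Fréchet differentiable at `y`: it is differentiable near `y`,
    -- with derivative `Φ'`, and `Φ'` is differentiable at `y` with derivative `Φ''`
    (Φ' : H₁ × H₂ → ((H₁ × H₂) →L[ℝ] ℝ))
    (Φ'' : (H₁ × H₂) →L[ℝ] ((H₁ × H₂) →L[ℝ] ℝ))
    (hΦ' : ∀ᶠ x in 𝓝 y, HasFDerivAt Φ (Φ' x) x)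
    (hΦ'' : HasFDerivAt Φ' Φ'' y)
    -- `Bᵢⱼ = ∂ᵢⱼΦ(y)` are the blocks of the second derivative
    (B₁₁ : H₁ →L[ℝ] H₁) (B₁₂ : H₂ →L[ℝ] H₁)
    (B₂₁ : H₁ →L[ℝ] H₂) (B₂₂ : H₂ →L[ℝ] H₂)
    (hB : ∀ (h₁ k₁ : H₁) (h₂ k₂ : H₂),
        Φ'' (h₁, h₂) (k₁, k₂) =
          ⟪B₁₁ h₁, k₁⟫ + ⟪B₁₂ h₂, k₁⟫ + ⟪B₂₁ h₁, k₂⟫ + ⟪B₂₂ h₂, k₂⟫)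
    -- (i) the partial derivatives of `Φ` vanish at `y`
    (hcrit₁ : ∀ h₁ : H₁, Φ' y (h₁, 0) = 0)
    (hcrit₂ : ∀ h₂ : H₂, Φ' y (0, h₂) = 0)
    -- (ii)
    (hpos₁ : IsPosDef B₁₁) (hpos₂ : IsPosDef B₂₂)
    -- (iii)
    (hschur₁ : IsPosDef (B₁₁ - B₁₂ ∘L Ring.inverse B₂₂ ∘L B₂₁))
    (hschur₂ : IsPosDef (B₂₂ - B₂₁ ∘L Ring.inverse B₁₁ ∘L B₁₂)) :
    -- `Φ` has a strong local minimum at `y`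
    ∃ U ∈ 𝓝 y, ∀ x ∈ U, x ≠ y → Φ y < Φ x := by
  have hsymm := second_derivative_symmetric_of_eventually hΦ' hΦ''
  have hsymm₁ : ∀ u w, ⟪B₁₁ u, w⟫ = ⟪B₁₁ w, u⟫ := fun u w ↦ by
    simpa [hB] using hsymm (u, 0) (w, 0)
  have hsymm₂ : ∀ v w, ⟪B₂₂ v, w⟫ = ⟪B₂₂ w, v⟫ := fun v w ↦ by
    simpa [hB] using hsymm (0, v) (0, w)
  have hmixed : ∀ u v, ⟪B₁₂ v, u⟫ = ⟪B₂₁ u, v⟫ := fun u v ↦ by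
    simpa [hB] using hsymm (0, v) (u, 0)
  have hcrit : Φ' y = 0 := by
    ext <;> simp [hcrit₁, hcrit₂]
  have hunit₁ := hpos₁.isUnit_s13
  have hunit₂ := hpos₂.isUnit_s13
  obtain ⟨a₁, ha₁, hpos₁⟩ := hpos₁
  obtain ⟨a₂, ha₂, hpos₂⟩ := hpos₂
  obtain ⟨c₁, hc₁, hschur₁⟩ := hschur₁
  obtain ⟨c₂, hc₂, hschur₂⟩ := hschur₂
  refine ⟨_, eventually_lt_of_coercive_second_derivative hΦ' hΦ'' hcrit (lt_min hc₁ hc₂) ?_,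
    fun x hx ↦ hx⟩
  rintro ⟨u, v⟩
  have hle₁ : c₁ * ‖u‖ ^ 2 ≤ Φ'' (u, v) (u, v) := by
    rw [hB]
    exact (hschur₁ u).trans (inner_schurComplement_le hmixed hsymm₂
      (fun w ↦ (by positivity : 0 ≤ a₂ * ‖w‖ ^ 2).trans (hpos₂ w)) hunit₂ u v)
  have hle₂ : c₂ * ‖v‖ ^ 2 ≤ Φ'' (u, v) (u, v) := by
    have := (hschur₂ v).trans (inner_schurComplement_le (A := B₂₂) (fun v u ↦ (hmixed u v).symm)
      hsymm₁ (fun w ↦ (by positivity : 0 ≤ a₁ * ‖w‖ ^ 2).trans (hpos₁ w)) hunit₁ v u)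
    rw [hB]
    linarith
  rw [Prod.norm_mk]
  rcases max_choice ‖u‖ ‖v‖ with hmax | hmax <;> rw [hmax]
  · exact (mul_le_mul_of_nonneg_right (min_le_left _ _) (by positivity)).trans hle₁
  · exact (mul_le_mul_of_nonneg_right (min_le_right _ _) (by positivity)).trans hle₂
end
end

section
/- Let H₁, H₂ be real Hilbert spaces and let Φ : H₁ × H₂ → ℝ be twice Fréchet differentiable at a point y ∈ H₁ × H₂ at which Φ has a local minimum. Suppose that ∂₁₁Φ(y) is continuously invertible. Then ∂₁Φ(y) = 0 and ∂₂Φ(y) = 0, and moreover ∂₁₁Φ(y) ≥ 0 and ∂₂₂Φ(y) − ∂₂₁Φ(y)·(∂₁₁Φ(y))⁻¹·∂₁₂Φ(y) ≥ 0. -/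
open ContinuousLinearMap RealInnerProductSpace Filter Topology

noncomputable section

/-- Second-order necessary condition: at a local minimum the second derivative is nonnegative
on the diagonal. -/
theorem IsLocalMin.secondDeriv_apply_self_nonneg {E : Type*} [NormedAddCommGroup E]
    [NormedSpace ℝ E] {f : E → ℝ} {x : E} {f' : E → E →L[ℝ] ℝ} {f'' : E →L[ℝ] E →L[ℝ] ℝ}
    (hmin : IsLocalMin f x) (hf' : ∀ᶠ z in 𝓝 x, HasFDerivAt f (f' z) z)
    (hf'' : HasFDerivAt f' f'' x) (h : E) : 0 ≤ f'' h h := by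
  by_contra! hneg
  have hline : ∀ t : ℝ, HasDerivAt (fun s : ℝ => x + s • h) h t := fun t => by
    simpa using ((hasDerivAt_id t).smul_const h).const_add x
  have htend : Tendsto (fun s : ℝ => x + s • h) (𝓝 0) (𝓝 x) := by
    simpa using (hline 0).continuousAt.tendsto
  have hderiv : ∀ᶠ t : ℝ in 𝓝 0,
      HasDerivAt (fun s : ℝ => f (x + s • h)) (f' (x + t • h) h) t :=
    (htend.eventually hf').mono fun t ht => ht.comp_hasDerivAt t (hline t)
  have hderiv2 : HasDerivAt (fun s : ℝ => f' (x + s • h) h) (f'' h h) 0 := by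
    have hx : HasFDerivAt (fun z => f' z h) (f''.flip h) (x + (0 : ℝ) • h) := by
      rw [zero_smul, add_zero]
      exact (ContinuousLinearMap.apply ℝ ℝ h).hasFDerivAt.comp x hf''
    exact hx.comp_hasDerivAt (0 : ℝ) (hline 0)
  have hcrit : f' x = 0 := hmin.hasFDerivAt_eq_zero hf'.self_of_nhds
  have hslope : ∀ᶠ t : ℝ in 𝓝[>] 0, f' (x + t • h) h < 0 := by
    have hlim := hderiv2.tendsto_slope.mono_left
      (nhdsWithin_mono (0 : ℝ) fun t (ht : 0 < t) => ht.ne')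
    filter_upwards [hlim.eventually (gt_mem_nhds hneg), self_mem_nhdsWithin] with t ht htpos
    have htpos : 0 < t := htpos
    simp only [slope_def_field, zero_smul, add_zero, hcrit, zero_apply, sub_zero] at ht
    exact (div_neg_iff.mp ht).elim (fun hc => absurd hc.2 htpos.not_gt) fun hc => hc.1
  obtain ⟨δ, hδ, hball⟩ := mem_nhdsGT_iff_exists_Ioo_subset.mp
    (hslope.and ((hderiv.and (htend.eventually hmin)).filter_mono nhdsWithin_le_nhds))
  have hδ : 0 < δ := hδ
  obtain ⟨c, hc, hslope_eq⟩ := exists_hasDerivAt_eq_slope (fun s : ℝ => f (x + s • h))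
    (fun s => f' (x + s • h) h) (half_pos hδ)
    (fun t ht => by
      rcases ht.1.eq_or_lt with rfl | ht0
      · exact hderiv.self_of_nhds.continuousAt.continuousWithinAt
      · exact (hball ⟨ht0, by linarith [ht.2]⟩).2.1.continuousAt.continuousWithinAt)
    (fun t ht => (hball ⟨ht.1, by linarith [ht.2]⟩).2.1)
  have hcneg := (hball ⟨hc.1, by linarith [hc.2]⟩).1
  have hge := (hball (a := δ / 2) ⟨half_pos hδ, half_lt_self hδ⟩).2.2
  have hnonneg : 0 ≤ f' (x + c • h) h := by
    rw [hslope_eq]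
    refine div_nonneg ?_ (by linarith)
    simpa using hge
  exact hcneg.not_ge hnonneg

theorem statement15
    {H₁ H₂ : Type*}
    [NormedAddCommGroup H₁] [InnerProductSpace ℝ H₁] [CompleteSpace H₁]
    [NormedAddCommGroup H₂] [InnerProductSpace ℝ H₂] [CompleteSpace H₂]
    (Φ : H₁ × H₂ → ℝ) (y : H₁ × H₂)
    -- `Φ` is twice Fréchet differentiable at `y`
    (Φ' : H₁ × H₂ → ((H₁ × H₂) →L[ℝ] ℝ))
    (Φ'' : (H₁ × H₂) →L[ℝ] ((H₁ × H₂) →L[ℝ] ℝ))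
    (hΦ' : ∀ᶠ x in 𝓝 y, HasFDerivAt Φ (Φ' x) x)
    (hΦ'' : HasFDerivAt Φ' Φ'' y)
    -- `Φ` has a local minimum at `y`
    (hmin : IsLocalMin Φ y)
    -- `Bᵢⱼ = ∂ᵢⱼΦ(y)` are the blocks of the second derivative
    (B₁₁ : H₁ →L[ℝ] H₁) (B₁₂ : H₂ →L[ℝ] H₁)
    (B₂₁ : H₁ →L[ℝ] H₂) (B₂₂ : H₂ →L[ℝ] H₂)
    (hB : ∀ (h₁ k₁ : H₁) (h₂ k₂ : H₂),
        Φ'' (h₁, h₂) (k₁, k₂) =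
          ⟪B₁₁ h₁, k₁⟫ + ⟪B₁₂ h₂, k₁⟫ + ⟪B₂₁ h₁, k₂⟫ + ⟪B₂₂ h₂, k₂⟫)
    -- `∂₁₁Φ(y)` is continuously invertible
    (hinv : IsUnit B₁₁) :
    (∀ h₁ : H₁, Φ' y (h₁, 0) = 0) ∧ (∀ h₂ : H₂, Φ' y (0, h₂) = 0) ∧
      IsNonnegOp B₁₁ ∧
      IsNonnegOp (B₂₂ - B₂₁ ∘L Ring.inverse B₁₁ ∘L B₁₂) := by
  have hcrit : Φ' y = 0 := hmin.hasFDerivAt_eq_zero hΦ'.self_of_nhds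
  have hnonneg := hmin.secondDeriv_apply_self_nonneg hΦ' hΦ''
  refine ⟨fun h₁ => by simp [hcrit], fun h₂ => by simp [hcrit], fun h => ?_, fun h => ?_⟩
  · simpa [hB] using hnonneg (h, 0)
  · have hcancel : B₁₁ (Ring.inverse B₁₁ (B₁₂ h)) = B₁₂ h :=
      DFunLike.congr_fun (Ring.mul_inverse_cancel B₁₁ hinv) (B₁₂ h)
    have hquad := hnonneg (-Ring.inverse B₁₁ (B₁₂ h), h)
    rw [hB, map_neg, map_neg, hcancel] at hquad
    simp only [inner_neg_left] at hquad
    simp only [sub_apply, coe_comp, Function.comp_apply, inner_sub_left]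
    linarith
end
end

section
/- Let H₁, H₂, H₃ be real Hilbert spaces and let Φ : H₁ × H₂ × H₃ → ℝ be twice Fréchet differentiable at a point y ∈ H₁ × H₂ × H₃ at which Φ has a local minimum. Write B_{ij} := ∂_{ij}Φ(y) and suppose that B₁₁ and B₂₂ − B₂₁·B₁₁⁻¹·B₁₂ are continuously invertible. Then ∂_iΦ(y) = 0 for i = 1, 2, 3, and moreover (i) B₁₁ ≥ 0; (ii) B₂₂ − B₂₁·B₁₁⁻¹·B₁₂ ≥ 0; and (iii) (B₃₃ − B₃₁B₁₁⁻¹B₁₃) − (B₃₂ − B₃₁B₁₁⁻¹B₁₂)·(B₂₂ − B₂₁B₁₁⁻¹B₁₂)⁻¹·(B₂₃ − B₂₁B₁₁⁻¹B₁₃) ≥ 0. -/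
open ContinuousLinearMap RealInnerProductSpace Filter Topology

noncomputable section

/-- Second-order necessary condition for a local minimum: the second derivative is nonnegative
on the diagonal. -/
theorem IsLocalMin.hasFDerivAt_second_nonneg {E : Type*} [NormedAddCommGroup E]
    [NormedSpace ℝ E] {f : E → ℝ} {f' : E → E →L[ℝ] ℝ} {f'' : E →L[ℝ] E →L[ℝ] ℝ} {x : E}
    (hmin : IsLocalMin f x) (hf' : ∀ᶠ z in 𝓝 x, HasFDerivAt f (f' z) z)
    (hf'' : HasFDerivAt f' f'' x) (h : E) : 0 ≤ f'' h h := by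
  have hline (t : ℝ) : HasDerivAt (fun t : ℝ ↦ x + t • h) h t := by
    simpa using ((hasDerivAt_id t).smul_const h).const_add x
  have htend : Tendsto (fun t : ℝ ↦ x + t • h) (𝓝 0) (𝓝 x) := by
    simpa using (hline 0).continuousAt.tendsto
  set g : ℝ → ℝ := fun t ↦ f (x + t • h) with hg
  have hg' : ∀ᶠ t in 𝓝 (0 : ℝ), HasDerivAt g (f' (x + t • h) h) t := by
    filter_upwards [htend.eventually hf'] with t ht
    exact ht.comp_hasDerivAt t (hline t)
  have hgmin : IsLocalMin g 0 := by
    filter_upwards [htend.eventually hmin] with t ht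
    simpa [hg] using ht
  have hderiv : deriv g =ᶠ[𝓝 0] fun t ↦ f' (x + t • h) h :=
    hg'.mono fun t ht ↦ ht.deriv
  have hg'' : HasDerivAt (deriv g) (f'' h h) 0 := by
    have hx : HasFDerivAt f' f'' (x + (0 : ℝ) • h) := by simpa using hf''
    have hcomp : HasDerivAt (fun t : ℝ ↦ f' (x + t • h)) (f'' h) 0 :=
      hx.comp_hasDerivAt (0 : ℝ) (hline 0)
    exact ((ContinuousLinearMap.apply ℝ ℝ h).hasFDerivAt.comp_hasDerivAt (0 : ℝ)
      hcomp).congr_of_eventuallyEq hderiv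
  by_contra! hneg
  have hmax : IsLocalMax g 0 := by
    refine isLocalMax_of_deriv_deriv_neg ?_ hgmin.deriv_eq_zero hg'.self_of_nhds.continuousAt
    rwa [hg''.deriv]
  have hconst : g =ᶠ[𝓝 0] fun _ ↦ g 0 := by
    filter_upwards [hmax, hgmin] with t h₁ h₂ using le_antisymm h₁ h₂
  have hzero : deriv (deriv g) 0 = 0 := by
    simpa using hconst.deriv.deriv_eq
  rw [hg''.deriv] at hzero
  exact hneg.ne hzero

theorem IsUnit.clm_apply_inverse_apply {H : Type*} [NormedAddCommGroup H] [NormedSpace ℝ H]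
    {A : H →L[ℝ] H} (hA : IsUnit A) (x : H) : A (Ring.inverse A x) = x :=
  DFunLike.congr_fun (Ring.mul_inverse_cancel A hA) x

theorem statement16
    {H₁ H₂ H₃ : Type*}
    [NormedAddCommGroup H₁] [InnerProductSpace ℝ H₁] [CompleteSpace H₁]
    [NormedAddCommGroup H₂] [InnerProductSpace ℝ H₂] [CompleteSpace H₂]
    [NormedAddCommGroup H₃] [InnerProductSpace ℝ H₃] [CompleteSpace H₃]
    (Φ : H₁ × H₂ × H₃ → ℝ) (y : H₁ × H₂ × H₃)
    -- `Φ` is twice Fréchet differentiable at `y`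
    (Φ' : H₁ × H₂ × H₃ → ((H₁ × H₂ × H₃) →L[ℝ] ℝ))
    (Φ'' : (H₁ × H₂ × H₃) →L[ℝ] ((H₁ × H₂ × H₃) →L[ℝ] ℝ))
    (hΦ' : ∀ᶠ x in 𝓝 y, HasFDerivAt Φ (Φ' x) x)
    (hΦ'' : HasFDerivAt Φ' Φ'' y)
    -- `Φ` has a local minimum at `y`
    (hmin : IsLocalMin Φ y)
    -- `Bᵢⱼ = ∂ᵢⱼΦ(y)` are the blocks of the second derivative
    (B₁₁ : H₁ →L[ℝ] H₁) (B₁₂ : H₂ →L[ℝ] H₁) (B₁₃ : H₃ →L[ℝ] H₁)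
    (B₂₁ : H₁ →L[ℝ] H₂) (B₂₂ : H₂ →L[ℝ] H₂) (B₂₃ : H₃ →L[ℝ] H₂)
    (B₃₁ : H₁ →L[ℝ] H₃) (B₃₂ : H₂ →L[ℝ] H₃) (B₃₃ : H₃ →L[ℝ] H₃)
    (hB : ∀ (h₁ k₁ : H₁) (h₂ k₂ : H₂) (h₃ k₃ : H₃),
        Φ'' (h₁, h₂, h₃) (k₁, k₂, k₃) =
          ⟪B₁₁ h₁ + B₁₂ h₂ + B₁₃ h₃, k₁⟫ + ⟪B₂₁ h₁ + B₂₂ h₂ + B₂₃ h₃, k₂⟫ +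
            ⟪B₃₁ h₁ + B₃₂ h₂ + B₃₃ h₃, k₃⟫)
    -- invertibility assumptions
    (hinv₁ : IsUnit B₁₁)
    (hinv₂ : IsUnit (B₂₂ - B₂₁ ∘L Ring.inverse B₁₁ ∘L B₁₂)) :
    (∀ h₁ : H₁, Φ' y (h₁, 0, 0) = 0) ∧ (∀ h₂ : H₂, Φ' y (0, h₂, 0) = 0) ∧
      (∀ h₃ : H₃, Φ' y (0, 0, h₃) = 0) ∧
      IsNonnegOp B₁₁ ∧
      IsNonnegOp (B₂₂ - B₂₁ ∘L Ring.inverse B₁₁ ∘L B₁₂) ∧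
      IsNonnegOp ((B₃₃ - B₃₁ ∘L Ring.inverse B₁₁ ∘L B₁₃) -
        (B₃₂ - B₃₁ ∘L Ring.inverse B₁₁ ∘L B₁₂) ∘L
          Ring.inverse (B₂₂ - B₂₁ ∘L Ring.inverse B₁₁ ∘L B₁₂) ∘L
            (B₂₃ - B₂₁ ∘L Ring.inverse B₁₁ ∘L B₁₃)) := by
  have hzero : Φ' y = 0 := hmin.hasFDerivAt_eq_zero hΦ'.self_of_nhds
  have hpos (h₁ : H₁) (h₂ : H₂) (h₃ : H₃) :
      0 ≤ ⟪B₁₁ h₁ + B₁₂ h₂ + B₁₃ h₃, h₁⟫ + ⟪B₂₁ h₁ + B₂₂ h₂ + B₂₃ h₃, h₂⟫ +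
        ⟪B₃₁ h₁ + B₃₂ h₂ + B₃₃ h₃, h₃⟫ := by
    rw [← hB]
    exact hmin.hasFDerivAt_second_nonneg hΦ' hΦ'' (h₁, h₂, h₃)
  have hA := hinv₁.clm_apply_inverse_apply
  have hS := hinv₂.clm_apply_inverse_apply
  set A := Ring.inverse B₁₁
  set T := Ring.inverse (B₂₂ - B₂₁ ∘L A ∘L B₁₂)
  refine ⟨by simp [hzero], by simp [hzero], by simp [hzero], fun h ↦ ?_, fun h ↦ ?_,
    fun h ↦ ?_⟩
  · simpa using hpos h 0 0
  · have hrow₁ : B₁₁ (-A (B₁₂ h)) + B₁₂ h + B₁₃ 0 = 0 := by simp [hA]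
    have hrow₂ : B₂₁ (-A (B₁₂ h)) + B₂₂ h + B₂₃ 0 = (B₂₂ - B₂₁ ∘L A ∘L B₁₂) h := by
      simp only [map_neg, map_zero, add_zero, sub_apply, comp_apply]
      abel
    simpa only [hrow₁, hrow₂, inner_zero_left, inner_zero_right, zero_add, add_zero]
      using hpos (-A (B₁₂ h)) h 0
  · -- Choose the first two components so that the first two block rows vanish.
    obtain ⟨h₂, hh₂⟩ : ∃ h₂, h₂ = -T ((B₂₃ - B₂₁ ∘L A ∘L B₁₃) h) := ⟨_, rfl⟩
    obtain ⟨h₁, hh₁⟩ : ∃ h₁, h₁ = -A (B₁₂ h₂ + B₁₃ h) := ⟨_, rfl⟩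
    have hrow₁ : B₁₁ h₁ + B₁₂ h₂ + B₁₃ h = 0 := by
      rw [hh₁, map_neg, hA]
      abel
    have hSh₂ : (B₂₂ - B₂₁ ∘L A ∘L B₁₂) h₂ = -(B₂₃ - B₂₁ ∘L A ∘L B₁₃) h := by
      rw [hh₂, map_neg, hS]
    have hrow₂ : B₂₁ h₁ + B₂₂ h₂ + B₂₃ h = 0 := by
      rw [← sub_eq_zero, sub_neg_eq_add] at hSh₂
      rw [← hSh₂, hh₁]
      simp only [map_neg, map_add, sub_apply, comp_apply]
      abel
    have hrow₃ : B₃₁ h₁ + B₃₂ h₂ + B₃₃ h =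
        ((B₃₃ - B₃₁ ∘L A ∘L B₁₃) -
          (B₃₂ - B₃₁ ∘L A ∘L B₁₂) ∘L T ∘L (B₂₃ - B₂₁ ∘L A ∘L B₁₃)) h := by
      rw [sub_apply, comp_apply, comp_apply, sub_eq_add_neg, ← map_neg, ← hh₂, hh₁]
      simp only [map_neg, map_add, sub_apply, comp_apply]
      abel
    simpa only [hrow₁, hrow₂, hrow₃, inner_zero_left, zero_add] using hpos h₁ h₂ h
end
end
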